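/- Let κ > 0, q ≥ 0, μ > 0, let F be (λ,Λ)-elliptic, let f be Lipschitz continuous on the closed ball B̄₁ with Lipschitz constant Lip(f), and let u be an effective viscosity solution of (|Du|−κ)₊^q F(D²u) = f in B₁ which is continuously differentiable on Ω_u. For a unit vector e ∈ ℝⁿ, define w : B₁ → ℝ by w(x) = (∂_e u(x) − (κ+μ))₊ for x ∈ Ω_u and w(x) = 0 otherwise. Then w is a viscosity subsolution of M⁺(D²w) + qμ^{−q−1}‖f‖_{L^∞(B₁)}|Dw| = −μ^{−q}Lip(f) in B₁; that is, for every x₀ ∈ B₁ and every C² function φ such that w − φ has a local maximum at x₀, one has M⁺(D²φ(x₀)) + qμ^{−q−1}‖f‖_{L^∞(B₁)}|Dφ(x₀)| ≥ −μ^{−q}Lip(f). -/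

import Mathlib

open Metric Set Matrix MeasureTheory
open scoped RealInnerProductSpace

noncomputable section

abbrev Euc (n : ℕ) := EuclideanSpace ℝ (Fin n)

def EllMat (n : ℕ) (lam Lam : ℝ) : Set (Matrix (Fin n) (Fin n) ℝ) :=
  {A | A.IsSymm ∧ ∀ ξ : Fin n → ℝ,
      lam * (ξ ⬝ᵥ ξ) ≤ ξ ⬝ᵥ A.mulVec ξ ∧ ξ ⬝ᵥ A.mulVec ξ ≤ Lam * (ξ ⬝ᵥ ξ)}

/-- Pucci maximal operator `M⁺`. -/
def pucciSup (n : ℕ) (lam Lam : ℝ) (M : Matrix (Fin n) (Fin n) ℝ) : ℝ :=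
  sSup ((fun A => (A * M).trace) '' EllMat n lam Lam)

/-- Pucci minimal operator `M⁻`. -/
def pucciInf (n : ℕ) (lam Lam : ℝ) (M : Matrix (Fin n) (Fin n) ℝ) : ℝ :=
  sInf ((fun A => (A * M).trace) '' EllMat n lam Lam)

/-- `(λ,Λ)`-ellipticity of `F`. -/
def IsUniformlyElliptic (n : ℕ) (lam Lam : ℝ)
    (F : Matrix (Fin n) (Fin n) ℝ → ℝ) : Prop :=
  ∀ M N : Matrix (Fin n) (Fin n) ℝ, M.IsSymm → N.IsSymm →
    pucciInf n lam Lam (M - N) ≤ F M - F N ∧ F M - F N ≤ pucciSup n lam Lam (M - N)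

/-- Hessian matrix of `φ` at `x`. -/
def hess {n : ℕ} (φ : Euc n → ℝ) (x : Euc n) : Matrix (Fin n) (Fin n) ℝ :=
  fun i j => iteratedFDeriv ℝ 2 φ x ![EuclideanSpace.single i 1, EuclideanSpace.single j 1]

/-- `κ`-grad viscosity subsolution of `G(Du, D²u) = f` in `s`. -/
def GradSubSol {n : ℕ} (κ : ℝ) (G : Euc n → Matrix (Fin n) (Fin n) ℝ → ℝ)
    (f : Euc n → ℝ) (s : Set (Euc n)) (u : Euc n → ℝ) : Prop :=
  ∀ x₀ ∈ s, ∀ φ : Euc n → ℝ, ContDiff ℝ 2 φ →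
    IsLocalMax (fun x => u x - φ x) x₀ → κ < ‖gradient φ x₀‖ →
    f x₀ ≤ G (gradient φ x₀) (hess φ x₀)

/-- `κ`-grad viscosity supersolution of `G(Du, D²u) = f` in `s`. -/
def GradSupSol {n : ℕ} (κ : ℝ) (G : Euc n → Matrix (Fin n) (Fin n) ℝ → ℝ)
    (f : Euc n → ℝ) (s : Set (Euc n)) (u : Euc n → ℝ) : Prop :=
  ∀ x₀ ∈ s, ∀ φ : Euc n → ℝ, ContDiff ℝ 2 φ →
    IsLocalMin (fun x => u x - φ x) x₀ → κ < ‖gradient φ x₀‖ →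
    G (gradient φ x₀) (hess φ x₀) ≤ f x₀

/-- `κ`-grad viscosity solution. -/
def GradSol {n : ℕ} (κ : ℝ) (G : Euc n → Matrix (Fin n) (Fin n) ℝ → ℝ)
    (f : Euc n → ℝ) (s : Set (Euc n)) (u : Euc n → ℝ) : Prop :=
  GradSubSol κ G f s u ∧ GradSupSol κ G f s u

/-- Classical viscosity solution (no restriction on the slope of test functions). -/
def ViscSol {n : ℕ} (G : Euc n → Matrix (Fin n) (Fin n) ℝ → ℝ)
    (f : Euc n → ℝ) (s : Set (Euc n)) (u : Euc n → ℝ) : Prop :=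
  (∀ x₀ ∈ s, ∀ φ : Euc n → ℝ, ContDiff ℝ 2 φ →
    IsLocalMax (fun x => u x - φ x) x₀ → f x₀ ≤ G (gradient φ x₀) (hess φ x₀)) ∧
  (∀ x₀ ∈ s, ∀ φ : Euc n → ℝ, ContDiff ℝ 2 φ →
    IsLocalMin (fun x => u x - φ x) x₀ → G (gradient φ x₀) (hess φ x₀) ≤ f x₀)

/-- The operator `G(ξ, M) = (|ξ|-κ)₊^q F(M)`. -/
def mainG {n : ℕ} (κ q : ℝ) (F : Matrix (Fin n) (Fin n) ℝ → ℝ) :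
    Euc n → Matrix (Fin n) (Fin n) ℝ → ℝ :=
  fun ξ M => max (‖ξ‖ - κ) 0 ^ q * F M

/-- The set `Ω_u` of points of `s` that can be touched from above or below by a `C²`
function with slope larger than `κ`. -/
def omegaSet {n : ℕ} (κ : ℝ) (s : Set (Euc n)) (u : Euc n → ℝ) : Set (Euc n) :=
  {x ∈ s | ∃ φ : Euc n → ℝ, ContDiff ℝ 2 φ ∧
    (IsLocalMax (fun y => u y - φ y) x ∨ IsLocalMin (fun y => u y - φ y) x) ∧
    κ < ‖gradient φ x‖}

/-- Effective viscosity solution of `(|Du|-κ)₊^q F(D²u) = f` in `s`. -/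
def EffectiveSol {n : ℕ} (κ q : ℝ) (F : Matrix (Fin n) (Fin n) ℝ → ℝ)
    (f : Euc n → ℝ) (s : Set (Euc n)) (u : Euc n → ℝ) : Prop :=
  IsOpen (omegaSet κ s u) ∧ ViscSol (mainG κ q F) f (omegaSet κ s u) u

section Convolutions

open Filter Topology MeasureTheory.Measure
open scoped NNReal

variable {E : Type*} [NormedAddCommGroup E]

/-- The quadratic sup-convolution `x ↦ sup_{z ∈ K} (v z - S ‖x - z‖²)`. -/
def supConv (K : Set E) (v : E → ℝ) (S : ℝ) (x : E) : ℝ :=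
  ⨆ z : K, (v z - S * ‖x - z‖ ^ 2)

lemma exists_isMax_supConv {K : Set E} (hK : IsCompact K) (hne : K.Nonempty) {v : E → ℝ}
    (hv : ContinuousOn v K) (S : ℝ) (x : E) :
    ∃ z ∈ K, ∀ z' ∈ K, v z' - S * ‖x - z'‖ ^ 2 ≤ v z - S * ‖x - z‖ ^ 2 := by
  have hc : ContinuousOn (fun z => v z - S * ‖x - z‖ ^ 2) K := by fun_prop
  obtain ⟨z, hz, h⟩ := hK.exists_isMaxOn hne hc
  exact ⟨z, hz, fun z' hz' => h hz'⟩

lemma le_supConv {K : Set E} (hK : IsCompact K) {v : E → ℝ} (hv : ContinuousOn v K) (S : ℝ)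
    (x : E) {z : E} (hz : z ∈ K) : v z - S * ‖x - z‖ ^ 2 ≤ supConv K v S x := by
  obtain ⟨z₀, -, h⟩ := exists_isMax_supConv hK ⟨z, hz⟩ hv S x
  exact le_ciSup (f := fun z : K => v z - S * ‖x - z‖ ^ 2)
    ⟨_, by rintro _ ⟨w, rfl⟩; exact h w w.2⟩ ⟨z, hz⟩

lemma supConv_le {K : Set E} (hne : K.Nonempty) {v : E → ℝ} {S : ℝ} {x : E} {b : ℝ}
    (h : ∀ z ∈ K, v z - S * ‖x - z‖ ^ 2 ≤ b) : supConv K v S x ≤ b :=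
  have := hne.to_subtype
  ciSup_le fun z => h z z.2

lemma exists_supConv_eq {K : Set E} (hK : IsCompact K) (hne : K.Nonempty) {v : E → ℝ}
    (hv : ContinuousOn v K) (S : ℝ) (x : E) :
    ∃ z ∈ K, supConv K v S x = v z - S * ‖x - z‖ ^ 2 := by
  obtain ⟨z, hz, h⟩ := exists_isMax_supConv hK hne hv S x
  exact ⟨z, hz, (supConv_le hne h).antisymm (le_supConv hK hv S x hz)⟩

lemma continuous_supConv {K : Set E} (hK : IsCompact K) {v : E → ℝ} (hv : ContinuousOn v K)
    (S : ℝ) : Continuous (supConv K v S) := by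
  have := isCompact_iff_compactSpace.mp hK
  have hv' : Continuous fun z : K => v z := continuousOn_iff_continuous_domRestrict.mp hv
  have h := (isCompact_univ (X := K)).continuous_sSup
    (f := fun (x : E) (z : K) => v z - S * ‖x - z‖ ^ 2) (by
      simp only [Function.HasUncurry.uncurry, id]
      exact (hv'.comp continuous_snd).sub (by fun_prop))
  simp only [image_univ, sSup_range] at h
  exact h

variable [InnerProductSpace ℝ E]

lemma norm_add_sq_add_norm_sub_sq (a h : E) :
    ‖a + h‖ ^ 2 + ‖a - h‖ ^ 2 = 2 * ‖a‖ ^ 2 + 2 * ‖h‖ ^ 2 := by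
  rw [norm_add_sq_real, norm_sub_sq_real]; ring

/-- Sup-convolutions are semiconvex. -/
lemma supConv_midpoint {K : Set E} (hK : IsCompact K) (hne : K.Nonempty) {v : E → ℝ}
    (hv : ContinuousOn v K) (S : ℝ) (x h : E) :
    2 * supConv K v S x - 2 * S * ‖h‖ ^ 2 ≤ supConv K v S (x + h) + supConv K v S (x - h) := by
  obtain ⟨z, hz, e⟩ := exists_supConv_eq hK hne hv S x
  have h1 := le_supConv hK hv S (x + h) hz
  have h2 := le_supConv hK hv S (x - h) hz
  have h3 := norm_add_sq_add_norm_sub_sq (x - z) h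
  rw [show x - z + h = x + h - z by abel, show x - z - h = x - h - z by abel] at h3
  rw [e]
  linear_combination h1 + h2 + S * h3

/-- A semiconvex function lying below a paraboloid that touches it at `x` also lies above one. -/
lemma abs_sub_le_of_midpoint {g : E → ℝ} {C D : ℝ}
    (hmid : ∀ x h, 2 * g x - C * ‖h‖ ^ 2 ≤ g (x + h) + g (x - h)) {x q : E}
    (hup : ∀ y, g y ≤ g x + ⟪q, y - x⟫ + D * ‖y - x‖ ^ 2) (hC : 0 ≤ C) (y : E) :
    |g y - g x - ⟪q, y - x⟫| ≤ (C + D) * ‖y - x‖ ^ 2 := by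
  have h1 := hmid x (y - x)
  have h2 := hup (x - (y - x))
  rw [add_sub_cancel] at h1
  rw [show x - (y - x) - x = -(y - x) by abel, inner_neg_right, norm_neg] at h2
  have h3 := hup y
  have h4 : 0 ≤ C * ‖y - x‖ ^ 2 := by positivity
  rw [abs_le]
  constructor <;> linarith

/-- Slopes at points of two-sided contact with paraboloids depend on the point in a Lipschitz
way. -/
lemma norm_slope_sub_le {g : E → ℝ} {C : ℝ} (hC : 0 < C) {x x' q q' : E}
    (hx : ∀ y, |g y - g x - ⟪q, y - x⟫| ≤ C * ‖y - x‖ ^ 2)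
    (hx' : ∀ y, |g y - g x' - ⟪q', y - x'⟫| ≤ C * ‖y - x'‖ ^ 2) :
    ‖q - q'‖ ≤ 6 * C * ‖x - x'‖ := by
  set w := q - q' with hw
  set k := (1 / (6 * C)) • w with hk
  have h1 := (abs_le.mp (hx (x' + k))).1
  have h2 := (abs_le.mp (hx x')).2
  have h3 := (abs_le.mp (hx' (x' + k))).2
  rw [add_sub_cancel_left] at h3
  rw [show x' + k - x = (x' - x) + k by abel, inner_add_right] at h1
  have h4 : ‖(x' - x) + k‖ ^ 2 ≤ 2 * ‖x' - x‖ ^ 2 + 2 * ‖k‖ ^ 2 := by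
    have := norm_add_sq_add_norm_sub_sq (x' - x) k
    nlinarith [sq_nonneg ‖(x' - x) - k‖]
  have h5 : ⟪q, k⟫ - ⟪q', k⟫ = 1 / (6 * C) * ‖w‖ ^ 2 := by
    rw [← inner_sub_left, ← hw, hk, inner_smul_right, real_inner_self_eq_norm_sq]
  have h6 : ‖k‖ ^ 2 = (1 / (6 * C)) ^ 2 * ‖w‖ ^ 2 := by
    rw [hk, norm_smul, mul_pow, Real.norm_eq_abs, sq_abs]
  have h7 : 1 / (6 * C) * ‖w‖ ^ 2 ≤ 3 * C * ‖x' - x‖ ^ 2 + 3 * C * ‖k‖ ^ 2 := by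
    have := mul_le_mul_of_nonneg_left h4 hC.le
    linarith
  rw [h6] at h7
  have h8 : ‖w‖ ^ 2 ≤ (6 * C * ‖x - x'‖) ^ 2 := by
    rw [norm_sub_rev x x']
    have e1 : 1 / (6 * C) * ‖w‖ ^ 2 * (12 * C) = 2 * ‖w‖ ^ 2 := by field_simp; ring
    have e2 : 3 * C * ((1 / (6 * C)) ^ 2 * ‖w‖ ^ 2) * (12 * C) = ‖w‖ ^ 2 := by
      field_simp; ring
    have := mul_le_mul_of_nonneg_right h7 (by positivity : 0 ≤ 12 * C)
    rw [add_mul, e1, e2] at this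
    linarith
  exact abs_le_of_sq_le_sq' h8 (by positivity) |>.2

lemma norm_sub_sq_quad (x y z : E) :
    ‖x - y‖ ^ 2 - ‖y - z‖ ^ 2 / 2 = ‖y - ((2 : ℝ) • x - z)‖ ^ 2 / 2 - ‖x - z‖ ^ 2 := by
  simp only [← real_inner_self_eq_norm_sq, inner_sub_left, inner_sub_right, inner_smul_left,
    inner_smul_right, real_inner_comm x y, real_inner_comm z y, real_inner_comm x z]
  simp
  ring

/-- A function which is both semiconvex and semiconcave, lying between a sup-convolution and any
semiconcave function above it. -/
lemma exists_between_supConv [FiniteDimensional ℝ E] {K : Set E} (hK : IsCompact K)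
    (hne : K.Nonempty) {v : E → ℝ} (hv : ContinuousOn v K) {S : ℝ} (hS : 0 < S) :
    ∃ (c : E → ℝ) (q : E → E), (∀ x, supConv K v S x ≤ c x) ∧
      (∀ b : E → ℝ, (∀ x, supConv K v S x ≤ b x) →
        ∀ x p : E, (∀ y, b y ≤ b x + ⟪p, y - x⟫ + S * ‖y - x‖ ^ 2) → c x ≤ b x) ∧
      ∀ x y, |c y - c x - ⟪q x, y - x⟫| ≤ 3 * S * ‖y - x‖ ^ 2 := by
  set A := supConv K v (S / 2) with hA
  have hAc : Continuous A := continuous_supConv hK hv _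
  have key : ∀ x, ∃ y, ∀ y', A y + S * ‖x - y‖ ^ 2 ≤ A y' + S * ‖x - y'‖ ^ 2 := by
    intro x
    obtain ⟨z, hz⟩ := hne
    have hcont : Continuous fun y => A y + S * ‖x - y‖ ^ 2 := by fun_prop
    apply hcont.exists_forall_le
    have h1 : Tendsto (fun y : E => ‖y - ((2 : ℝ) • x - z)‖) (cocompact E) atTop :=
      tendsto_norm_cocompact_atTop.comp
        (Homeomorph.subRight ((2 : ℝ) • x - z)).isClosedEmbedding.tendsto_cocompact
    have h2 : Tendsto (fun y : E => (v z - S * ‖x - z‖ ^ 2) +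
        S / 2 * ‖y - ((2 : ℝ) • x - z)‖ ^ 2) (cocompact E) atTop :=
      tendsto_atTop_add_const_left _ _
        (((tendsto_pow_atTop two_ne_zero).comp h1).const_mul_atTop (by positivity))
    refine tendsto_atTop_mono (fun y => ?_) h2
    have h3 := le_supConv hK hv (S / 2) y hz
    have h4 := norm_sub_sq_quad x y z
    rw [← hA] at h3
    linear_combination h3 - S * h4
  choose Y hY using key
  set c : E → ℝ := fun x => A (Y x) + S * ‖x - Y x‖ ^ 2 with hc
  have hcle : ∀ x y, c x ≤ A y + S * ‖x - y‖ ^ 2 := hY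
  refine ⟨c, fun x => (2 * S) • (x - Y x), ?_, ?_, ?_⟩
  · intro x
    refine supConv_le hne fun z hz => ?_
    have h3 := le_supConv hK hv (S / 2) (Y x) hz
    have h4 := norm_sub_sq_quad x (Y x) z
    rw [← hA] at h3
    have h5 : 0 ≤ S * ‖Y x - ((2 : ℝ) • x - z)‖ ^ 2 := by positivity
    simp only [hc]
    linear_combination h3 - S * h4 + h5 / 2
  · intro b hb x p hp
    set y₀ := x - (1 / (2 * S)) • p with hy₀
    have hpar : ∀ y, ⟪p, y - x⟫ + S * ‖y - x‖ ^ 2 =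
        S * ‖y - y₀‖ ^ 2 - S * ‖x - y₀‖ ^ 2 := by
      intro y
      have e1 : y - y₀ = (y - x) + (1 / (2 * S)) • p := by rw [hy₀]; abel
      have e2 : x - y₀ = (1 / (2 * S)) • p := by rw [hy₀]; abel
      rw [e1, e2, norm_add_sq_real, inner_smul_right, real_inner_comm]
      field_simp
      ring
    have h1 : A y₀ ≤ b x - S * ‖x - y₀‖ ^ 2 := by
      refine supConv_le hne fun z hz => ?_
      set m := (1 / 2 : ℝ) • (z + y₀) with hm
      have h2 := le_supConv hK hv S m hz
      have h3 := hb m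
      have h4 := hp m
      have h5 := hpar m
      have e1 : m - z = (1 / 2 : ℝ) • (y₀ - z) := by rw [hm]; module
      have e2 : m - y₀ = -((1 / 2 : ℝ) • (y₀ - z)) := by rw [hm]; module
      rw [e1, norm_smul] at h2
      rw [e2, norm_neg, norm_smul] at h5
      norm_num at h2 h5
      linarith
    have := hcle x y₀
    linarith
  · intro x y
    have hmid : ∀ x h, 2 * c x - 2 * S * ‖h‖ ^ 2 ≤ c (x + h) + c (x - h) := by
      intro x h
      set y₁ := Y (x + h) with hy₁
      set y₂ := Y (x - h) with hy₂
      set m := (1 / 2 : ℝ) • (y₁ + y₂) with hm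
      set k := (1 / 2 : ℝ) • (y₁ - y₂) with hk
      have h1 := hcle x m
      have h2 := supConv_midpoint hK hne hv (S / 2) m k
      have e1 : m + k = y₁ := by rw [hm, hk]; module
      have e2 : m - k = y₂ := by rw [hm, hk]; module
      rw [e1, e2, ← hA] at h2
      have h3 := norm_add_sq_add_norm_sub_sq (x - m) (h - k)
      rw [show x - m + (h - k) = x + h - (m + k) by abel,
        show x - m - (h - k) = x - h - (m - k) by abel, e1, e2] at h3
      have h4 : 0 ≤ S * ‖(2 : ℝ) • h - k‖ ^ 2 := by positivity
      rw [norm_sub_sq_real, norm_smul, inner_smul_left] at h4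
      norm_num at h4
      have h5 := norm_sub_sq_real h k
      have e3 : c (x + h) = A y₁ + S * ‖x + h - y₁‖ ^ 2 := rfl
      have e4 : c (x - h) = A y₂ + S * ‖x - h - y₂‖ ^ 2 := rfl
      rw [e3, e4]
      rw [h5] at h3
      linear_combination 2 * h1 + h2 + h4 - S * h3
    have hup : ∀ y, c y ≤ c x + ⟪(2 * S) • (x - Y x), y - x⟫ + S * ‖y - x‖ ^ 2 := by
      intro y
      have h1 := hcle y (Y x)
      rw [show y - Y x = (x - Y x) + (y - x) by abel, norm_add_sq_real] at h1
      rw [inner_smul_left]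
      simp only [hc, conj_trivial]
      linarith
    convert abs_sub_le_of_midpoint hmid hup (by positivity) y using 2
    ring

/-- A function trapped at every point between two paraboloids is differentiable. -/
lemma hasGradientAt_of_abs_sub_le [CompleteSpace E] {g : E → ℝ} {C : ℝ} {x q : E}
    (hx : ∀ y, |g y - g x - ⟪q, y - x⟫| ≤ C * ‖y - x‖ ^ 2) : HasGradientAt g q x := by
  rw [hasGradientAt_iff_isLittleO]
  refine Asymptotics.IsBigO.trans_isLittleO (g := fun y => ‖y - x‖ ^ 2)
    (Asymptotics.IsBigO.of_bound C (.of_forall fun y => ?_)) ?_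
  · simpa using hx y
  · have := (Asymptotics.isLittleO_norm_pow_id (E' := E) one_lt_two).comp_tendsto
      (show Tendsto (fun y => y - x) (𝓝 x) (𝓝 0) from by
        simpa using (continuous_sub_right x).tendsto x)
    simpa [Function.comp_def] using this

/-- Second order Taylor expansion at a point of differentiability of the gradient. -/
lemma eventually_abs_taylor_two_le [CompleteSpace E] {g : E → ℝ} {q : E → E} {x : E}
    {X : E →L[ℝ] E} (hg : ∀ᶠ y in 𝓝 x, HasGradientAt g (q y) y) (hX : HasFDerivAt q X x)
    {η : ℝ} (hη : 0 < η) :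
    ∀ᶠ h in 𝓝 (0 : E),
      |g (x + h) - g x - ⟪q x, h⟫ - 1 / 2 * ⟪X h, h⟫| ≤ η * ‖h‖ ^ 2 := by
  have h1 : ∀ᶠ y in 𝓝 x, ‖q y - q x - X (y - x)‖ ≤ η * ‖y - x‖ :=
    hX.isLittleO.def hη
  obtain ⟨δ, hδ, hball⟩ := Metric.eventually_nhds_iff_ball.mp (hg.and h1)
  refine Metric.eventually_nhds_iff_ball.mpr ⟨δ, hδ, fun h hh => ?_⟩
  rw [mem_ball_zero_iff] at hh
  have hmem : ∀ t ∈ Icc (0 : ℝ) 1, x + t • h ∈ ball x δ := by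
    intro t ht
    rw [mem_ball, dist_eq_norm, add_sub_cancel_left, norm_smul, Real.norm_of_nonneg ht.1]
    exact (mul_le_of_le_one_left (norm_nonneg h) ht.2).trans_lt hh
  have hder : ∀ t ∈ Icc (0 : ℝ) 1, HasDerivWithinAt
      (fun t : ℝ => g (x + t • h) - t * ⟪q x, h⟫ - t ^ 2 * (1 / 2 * ⟪X h, h⟫))
      (⟪q (x + t • h) - q x - X (t • h), h⟫) (Icc 0 1) t := by
    intro t ht
    have d1 : HasDerivAt (fun t : ℝ => x + t • h) h t := by
      simpa using ((hasDerivAt_id t).smul_const h).const_add x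
    have d2 := ((hball _ (hmem t ht)).1.hasFDerivAt).comp_hasDerivAt t d1
    have d3 := (d2.sub ((hasDerivAt_id t).mul_const ⟪q x, h⟫)).sub
      ((hasDerivAt_pow 2 t).mul_const (1 / 2 * ⟪X h, h⟫))
    refine (d3.congr_deriv ?_).hasDerivWithinAt
    simp [inner_sub_left, inner_smul_left]
    ring
  have hb : ∀ t ∈ Ico (0 : ℝ) 1, ‖⟪q (x + t • h) - q x - X (t • h), h⟫‖ ≤ η * ‖h‖ ^ 2 := by
    intro t ht
    have ht' : t ∈ Icc (0 : ℝ) 1 := ⟨ht.1, ht.2.le⟩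
    have h2 := (hball _ (hmem t ht')).2
    rw [add_sub_cancel_left] at h2
    calc _ ≤ ‖q (x + t • h) - q x - X (t • h)‖ * ‖h‖ := norm_inner_le_norm _ _
      _ ≤ (η * ‖t • h‖) * ‖h‖ := by gcongr
      _ ≤ (η * ‖h‖) * ‖h‖ := by
        gcongr
        rw [norm_smul, Real.norm_of_nonneg ht.1]
        exact mul_le_of_le_one_left (norm_nonneg h) ht.2.le
      _ = _ := by ring
  have := norm_image_sub_le_of_norm_deriv_le_segment_01' hder hb
  rw [Real.norm_eq_abs] at this
  convert this using 2
  simp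
  ring

/-- The points at which a semiconvex function is touched from above by affine functions with
slopes in a ball form a set that is not negligible. -/
lemma exists_notMem_of_midpoint [FiniteDimensional ℝ E] [MeasurableSpace E] [BorelSpace E]
    {W : E → ℝ} {C : ℝ} (hC : 0 < C)
    (hmid : ∀ x h, 2 * W x - C * ‖h‖ ^ 2 ≤ W (x + h) + W (x - h)) {δ : ℝ} (hδ : 0 < δ)
    {ξ : E → E} (hξ : ∀ p ∈ ball (0 : E) δ, ∀ y, W y ≤ W (ξ p) + ⟪p, y - ξ p⟫) {N : Set E}
    (hN : μH[Module.finrank ℝ E] N = 0) : ∃ p ∈ ball (0 : E) δ, ξ p ∉ N := by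
  by_contra! hcon
  have h2 : ∀ p ∈ ball (0 : E) δ, ∀ y,
      |W y - W (ξ p) - ⟪p, y - ξ p⟫| ≤ C * ‖y - ξ p‖ ^ 2 := by
    intro p hp y
    simpa using abs_sub_le_of_midpoint (D := 0) hmid (by simpa using hξ p hp) hC.le y
  have hlip : ∀ p ∈ ball (0 : E) δ, ∀ p' ∈ ball (0 : E) δ, ‖p - p'‖ ≤ 6 * C * ‖ξ p - ξ p'‖ :=
    fun p hp p' hp' => norm_slope_sub_le hC (h2 p hp) (h2 p' hp')
  have hinj : InjOn ξ (ball 0 δ) := by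
    intro p hp p' hp' h
    have := hlip p hp p' hp'
    rw [h, sub_self, norm_zero, mul_zero] at this
    exact sub_eq_zero.mp (norm_le_zero_iff.mp this)
  set G := Function.invFunOn ξ (ball 0 δ) with hG
  have hGl : ∀ p ∈ ball (0 : E) δ, G (ξ p) = p := fun p hp => hinj.leftInvOn_invFunOn hp
  have hGlip : LipschitzOnWith (6 * C).toNNReal G (ξ '' ball 0 δ) := by
    refine LipschitzOnWith.of_dist_le_mul ?_
    rintro _ ⟨p, hp, rfl⟩ _ ⟨p', hp', rfl⟩
    rw [hGl p hp, hGl p' hp', dist_eq_norm, dist_eq_norm, Real.coe_toNNReal _ (by positivity)]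
    exact hlip p hp p' hp'
  have hsub : ξ '' ball 0 δ ⊆ N := by rintro _ ⟨p, hp, rfl⟩; exact hcon p hp
  have hnull : μH[Module.finrank ℝ E] (ξ '' ball 0 δ) = 0 := MeasureTheory.measure_mono_null hsub hN
  have himg := hGlip.hausdorffMeasure_image_le (d := Module.finrank ℝ E) (by positivity)
  rw [hnull, mul_zero, image_image, image_congr (g := id) (fun p hp => hGl p hp), image_id] at himg
  exact (measure_ball_pos μH[Module.finrank ℝ E] (0 : E) hδ).ne' (le_antisymm himg bot_le)


/-- A semiconvex and semiconcave function has a second order Taylor expansion almost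
everywhere. -/
lemma hausdorffMeasure_not_differentiableAt_slope [FiniteDimensional ℝ E] [MeasurableSpace E]
    [BorelSpace E] {g : E → ℝ} {q : E → E} {C : ℝ} (hC : 0 < C)
    (hg : ∀ x y, |g y - g x - ⟪q x, y - x⟫| ≤ C * ‖y - x‖ ^ 2) :
    μH[Module.finrank ℝ E] {x | ¬ DifferentiableAt ℝ q x} = 0 := by
  have hlip : LipschitzWith (6 * C).toNNReal q := by
    refine LipschitzWith.of_dist_le_mul fun x y => ?_
    rw [dist_eq_norm, dist_eq_norm, Real.coe_toNNReal _ (by positivity)]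
    exact norm_slope_sub_le hC (hg x) (hg y)
  exact hlip.ae_differentiableAt (μ := μH[Module.finrank ℝ E])

lemma doubling_identity {S : ℝ} (hS : 0 < S) (p x z y x₁ : E) :
    -(S * ‖x - z‖ ^ 2) - S * ‖x - y‖ ^ 2 - ⟪p, x - x₁⟫ =
      -(2 * S * ‖x - ((1 / 2 : ℝ) • (z + y) - (1 / (4 * S)) • p)‖ ^ 2) + ‖p‖ ^ 2 / (8 * S)
        - S / 2 * ‖z - y‖ ^ 2 - ⟪p, (1 / 2 : ℝ) • (z + y) - x₁⟫ := by
  set m := (1 / 2 : ℝ) • (z + y) with hm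
  set d := (1 / 2 : ℝ) • (z - y) with hd
  have e1 : x - z = (x - m) - d := by rw [hm, hd]; module
  have e2 : x - y = (x - m) + d := by rw [hm, hd]; module
  have e3 : z - y = (2 : ℝ) • d := by rw [hd]; module
  have e4 : x - (m - (1 / (4 * S)) • p) = (x - m) + (1 / (4 * S)) • p := by abel
  have e5 : x - x₁ = (x - m) + (m - x₁) := by abel
  have h := norm_add_sq_add_norm_sub_sq (x - m) d
  rw [e1, e2, e3, e4, e5, norm_add_sq_real (x - m) ((1 / (4 * S)) • p), norm_smul, norm_smul,
    inner_smul_right, inner_add_right, real_inner_comm p (x - m)]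
  simp only [mul_pow, Real.norm_eq_abs, sq_abs]
  field_simp
  linear_combination -128 * S ^ 2 * h

/-- A form of the Jensen–Ishii lemma: near a strict local maximum of `v - u`, after
an arbitrarily small perturbation, `v` and `u` are touched by quadratic functions with the same
second order part. -/
lemma exists_second_order_touching [FiniteDimensional ℝ E] {x₁ : E} {r ρ γ η : ℝ} {v u : E → ℝ}
    (hv : ContinuousOn v (closedBall x₁ r)) (hu : ContinuousOn u (closedBall x₁ r))
    (hρ : 0 < ρ) (hρr : ρ < r) (hγ : 0 < γ) (hη : 0 < η)
    (hgap : ∀ x ∈ closedBall x₁ r, ρ ≤ ‖x - x₁‖ → v x - u x ≤ v x₁ - u x₁ - γ) :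
    ∃ (z y p q : E) (X : E →L[ℝ] E), z ∈ ball x₁ ρ ∧ y ∈ ball x₁ r ∧ ‖z - y‖ < η ∧ ‖p‖ < η ∧
      (∀ᶠ h in 𝓝 (0 : E), v (z + h) ≤ v z + ⟪q, h⟫ + 1 / 2 * ⟪X h, h⟫ + η * ‖h‖ ^ 2) ∧
      ∀ᶠ h in 𝓝 (0 : E), u y + ⟪q - p, h⟫ + 1 / 2 * ⟪X h, h⟫ - η * ‖h‖ ^ 2 ≤ u (y + h) := by
  borelize E
  set K := closedBall x₁ r with hKdef
  have hr : 0 < r := hρ.trans hρr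
  have hK : IsCompact K := isCompact_closedBall x₁ r
  have hx₁ : x₁ ∈ K := mem_closedBall_self hr.le
  have hne : K.Nonempty := ⟨x₁, hx₁⟩
  obtain ⟨M₁, hM₁⟩ := hK.exists_bound_of_continuousOn hv
  obtain ⟨M₂, hM₂⟩ := hK.exists_bound_of_continuousOn hu
  obtain ⟨ζ₀, hζ₀, hunif⟩ := Metric.uniformContinuousOn_iff.mp
    (hK.uniformContinuousOn_of_continuous hu) (γ / 4) (by positivity)
  obtain ⟨ζ, hζ, hζζ₀, hζη, hζr⟩ : ∃ ζ > 0, ζ ≤ ζ₀ ∧ ζ ≤ η ∧ ζ ≤ r - ρ :=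
    ⟨min ζ₀ (min η (r - ρ)), by simp [hζ₀, hη, hρr], min_le_left _ _,
      (min_le_right _ _).trans (min_le_left _ _), (min_le_right _ _).trans (min_le_right _ _)⟩
  obtain ⟨δ, hδ, hδη, hδr⟩ : ∃ δ > 0, δ ≤ η ∧ δ * r ≤ γ / 4 := by
    refine ⟨min η (γ / 4 / r), by positivity, min_le_left _ _, ?_⟩
    exact (le_div_iff₀ hr).mp (min_le_right _ _)
  obtain ⟨S, hS, hSζ⟩ : ∃ S > 0, 2 * M₁ + 2 * M₂ + γ < S / 2 * ζ ^ 2 := by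
    have h0 : 0 ≤ M₁ := (norm_nonneg _).trans (hM₁ x₁ hx₁)
    have h0' : 0 ≤ M₂ := (norm_nonneg _).trans (hM₂ x₁ hx₁)
    refine ⟨(4 * M₁ + 4 * M₂ + 2 * γ + 2) / ζ ^ 2, by positivity, ?_⟩
    field_simp
    linarith
  -- the doubled functional
  set Φ : E → E × E → ℝ := fun p w =>
    v w.1 - u w.2 - S / 2 * ‖w.1 - w.2‖ ^ 2 - ⟪p, (1 / 2 : ℝ) • (w.1 + w.2) - x₁⟫ with hΦ
  have hmax : ∀ p, ∃ w ∈ K ×ˢ K, ∀ w' ∈ K ×ˢ K, Φ p w' ≤ Φ p w := by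
    intro p
    have hc : ContinuousOn (Φ p) (K ×ˢ K) := by
      have h1 : ContinuousOn (fun w : E × E => v w.1) (K ×ˢ K) :=
        hv.comp continuousOn_fst fun w hw => hw.1
      have h2 : ContinuousOn (fun w : E × E => u w.2) (K ×ˢ K) :=
        hu.comp continuousOn_snd fun w hw => hw.2
      exact ((h1.sub h2).sub (by fun_prop)).sub (by fun_prop)
    obtain ⟨w, hw, h⟩ := (hK.prod hK).exists_isMaxOn (hne.prod hne) hc
    exact ⟨w, hw, fun w' hw' => h hw'⟩
  choose w hwK hw using hmax
  have hclose : ∀ p ∈ ball (0 : E) δ, ‖(w p).1 - (w p).2‖ < ζ ∧ ‖(w p).1 - x₁‖ < ρ := by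
    intro p hp
    rw [mem_ball_zero_iff] at hp
    obtain ⟨hz, hy⟩ := hwK p
    have h1 := hw p (x₁, x₁) ⟨hx₁, hx₁⟩
    have e1 : (1 / 2 : ℝ) • (x₁ + x₁) - x₁ = 0 := by module
    simp only [hΦ, e1, sub_self, norm_zero, inner_zero_right] at h1
    have h2 : ‖(1 / 2 : ℝ) • ((w p).1 + (w p).2) - x₁‖ ≤ r := by
      have := (convex_closedBall x₁ r) hz hy (by norm_num : (0 : ℝ) ≤ 1 / 2)
        (by norm_num : (0 : ℝ) ≤ 1 / 2) (by norm_num)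
      rwa [← smul_add, mem_closedBall, dist_eq_norm] at this
    have h3 : |⟪p, (1 / 2 : ℝ) • ((w p).1 + (w p).2) - x₁⟫| ≤ γ / 4 := by
      refine (abs_real_inner_le_norm _ _).trans (le_trans ?_ hδr)
      gcongr
    have h4 := (abs_le.mp h3).1
    have b1 := abs_le.mp (hM₁ _ hz)
    have b2 := abs_le.mp (hM₁ _ hx₁)
    have b3 := abs_le.mp (hM₂ _ hy)
    have b4 := abs_le.mp (hM₂ _ hx₁)
    have h5 : ‖(w p).1 - (w p).2‖ < ζ := by
      by_contra! hcon
      have : S / 2 * ζ ^ 2 ≤ S / 2 * ‖(w p).1 - (w p).2‖ ^ 2 := by gcongr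
      linarith [b1.2, b2.1, b3.1, b4.2]
    refine ⟨h5, ?_⟩
    by_contra! hcon
    have h6 := hgap _ hz hcon
    have h7 := hunif _ hz _ hy (by rw [dist_eq_norm]; exact h5.trans_le hζζ₀)
    rw [Real.dist_eq] at h7
    have h8 := (abs_lt.mp h7).2
    have h9 : 0 ≤ S / 2 * ‖(w p).1 - (w p).2‖ ^ 2 := by positivity
    linarith
  have hun : ContinuousOn (fun x => -u x) K := hu.neg
  set a := supConv K v S with ha
  set b := supConv K (fun x => -u x) S with hb
  set ξ : E → E := fun p => (1 / 2 : ℝ) • ((w p).1 + (w p).2) - (1 / (4 * S)) • p with hξ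
  have hval : ∀ p x, a x + b x - ⟪p, x - x₁⟫ ≤ Φ p (w p) + ‖p‖ ^ 2 / (8 * S) := by
    intro p x
    obtain ⟨z, hz, e1⟩ := exists_supConv_eq hK hne hv S x
    obtain ⟨y, hy, e2⟩ := exists_supConv_eq hK hne hun S x
    have h1 := doubling_identity hS p x z y x₁
    have h2 := hw p (z, y) ⟨hz, hy⟩
    have h3 : 0 ≤ 2 * S * ‖x - ((1 / 2 : ℝ) • (z + y) - (1 / (4 * S)) • p)‖ ^ 2 := by positivity
    rw [ha, hb, e1, e2]
    simp only [hΦ] at h2 ⊢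
    linarith
  have hΦeq : ∀ p, v (w p).1 - S * ‖ξ p - (w p).1‖ ^ 2 + (-u (w p).2 - S * ‖ξ p - (w p).2‖ ^ 2)
      - ⟪p, ξ p - x₁⟫ = Φ p (w p) + ‖p‖ ^ 2 / (8 * S) := by
    intro p
    have h1 := doubling_identity hS p (ξ p) (w p).1 (w p).2 x₁
    rw [show (1 / 2 : ℝ) • ((w p).1 + (w p).2) - (1 / (4 * S)) • p = ξ p from rfl, sub_self,
      norm_zero] at h1
    simp only [hΦ]
    linarith
  have hage : ∀ p, v (w p).1 - S * ‖ξ p - (w p).1‖ ^ 2 ≤ a (ξ p) := fun p =>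
    le_supConv hK hv S _ (hwK p).1
  have hbge : ∀ p, -u (w p).2 - S * ‖ξ p - (w p).2‖ ^ 2 ≤ b (ξ p) := fun p =>
    le_supConv hK hun S _ (hwK p).2
  have htouch : ∀ p ∈ ball (0 : E) δ, ∀ y, a y + b y ≤ a (ξ p) + b (ξ p) + ⟪p, y - ξ p⟫ := by
    intro p _ y
    have h1 := hval p y
    have h2 := hΦeq p
    have e : ⟪p, y - x₁⟫ = ⟪p, y - ξ p⟫ + ⟪p, ξ p - x₁⟫ := by
      rw [← inner_add_right]; congr 1; abel
    linarith [hage p, hbge p]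
  have hmid : ∀ x h, 2 * (a x + b x) - 4 * S * ‖h‖ ^ 2 ≤
      a (x + h) + b (x + h) + (a (x - h) + b (x - h)) := by
    intro x h
    linarith [supConv_midpoint hK hne hv S x h, supConv_midpoint hK hne hun S x h]
  obtain ⟨c, q, hac, hcb, hcq⟩ := exists_between_supConv hK hne hv hS
  have hnull := hausdorffMeasure_not_differentiableAt_slope (by positivity : 0 < 3 * S) hcq
  obtain ⟨p, hp, hdiff⟩ := exists_notMem_of_midpoint (W := fun x => a x + b x)
    (by positivity : 0 < 4 * S) hmid hδ htouch hnull
  simp only [mem_ofPred_eq, not_not] at hdiff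
  obtain ⟨hzy, hzx⟩ := hclose p hp
  obtain ⟨hz, hy⟩ := hwK p
  have haeq : a (ξ p) = v (w p).1 - S * ‖ξ p - (w p).1‖ ^ 2 := by
    linarith [hval p (ξ p), hΦeq p, hage p, hbge p]
  have hbeq : b (ξ p) = -u (w p).2 - S * ‖ξ p - (w p).2‖ ^ 2 := by
    linarith [hval p (ξ p), hΦeq p, hage p, hbge p]
  have hzball : (w p).1 ∈ ball x₁ ρ := by rwa [mem_ball, dist_eq_norm]
  have hyball : (w p).2 ∈ ball x₁ r := by
    rw [mem_ball, dist_eq_norm]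
    calc ‖(w p).2 - x₁‖ = ‖((w p).1 - x₁) - ((w p).1 - (w p).2)‖ := by congr 1; abel
      _ ≤ ‖(w p).1 - x₁‖ + ‖(w p).1 - (w p).2‖ := norm_sub_le _ _
      _ < r := by linarith
  -- `c` lies below the perturbation of `-b` touching `a` at `ξ p`
  have hcle : ∀ x, c x ≤ a (ξ p) + b (ξ p) + ⟪p, x - ξ p⟫ - b x := by
    intro x
    obtain ⟨y, hyK, e⟩ := exists_supConv_eq hK hne hun S x
    refine hcb (fun x => a (ξ p) + b (ξ p) + ⟪p, x - ξ p⟫ - b x)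
      (fun x => by linarith [htouch p hp x]) x (p + (2 * S) • (x - y)) fun x' => ?_
    have h1 := le_supConv hK hun S x' hyK
    have e1 : x' - ξ p = (x' - x) + (x - ξ p) := by abel
    have e2 : x' - y = (x - y) + (x' - x) := by abel
    rw [e2, norm_add_sq_real] at h1
    rw [e1, inner_add_right, inner_add_left, inner_smul_left]
    simp only [conj_trivial]
    rw [← hb] at h1 e
    linarith
  have hcξ : c (ξ p) = a (ξ p) := by
    refine le_antisymm ?_ (hac _)
    have := hcle (ξ p)
    rw [sub_self, inner_zero_right] at this
    linarith
  have hgrad : ∀ x, HasGradientAt c (q x) x := fun x => hasGradientAt_of_abs_sub_le (hcq x)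
  have htaylor := eventually_abs_taylor_two_le (.of_forall hgrad) hdiff.hasFDerivAt hη
  have hnear : ∀ x ∈ ball x₁ r, ∀ᶠ h in 𝓝 (0 : E), x + h ∈ K := by
    intro x hx
    have : Tendsto (fun h : E => x + h) (𝓝 0) (𝓝 x) := by
      simpa using (continuous_const_add x).tendsto 0
    exact this.eventually (mem_of_superset (isOpen_ball.mem_nhds hx) ball_subset_closedBall)
  refine ⟨(w p).1, (w p).2, p, q (ξ p), fderiv ℝ q (ξ p), hzball, hyball, hzy.trans_le hζη,
    (mem_ball_zero_iff.mp hp).trans_le hδη, ?_, ?_⟩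
  · filter_upwards [htaylor, hnear _ (ball_subset_ball hρr.le hzball)] with h h1 h2
    have h3 := le_supConv hK hv S (ξ p + h) h2
    rw [add_sub_add_right_eq_sub] at h3
    have h4 := hac (ξ p + h)
    have h5 := (abs_le.mp h1).2
    rw [← ha] at h3
    linarith
  · filter_upwards [htaylor, hnear _ hyball] with h h1 h2
    have h3 := le_supConv hK hun S (ξ p + h) h2
    rw [add_sub_add_right_eq_sub] at h3
    have h4 := hcle (ξ p + h)
    rw [add_sub_cancel_left] at h4
    have h5 := (abs_le.mp h1).1
    rw [← hb] at h3
    rw [inner_sub_left]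
    linarith

end Convolutions

section TestFunctions

open Filter Topology ContinuousLinearMap

variable {n : ℕ}

/-- The matrix of the symmetric part of a continuous linear map. -/
def symMat (X : Euc n →L[ℝ] Euc n) : Matrix (Fin n) (Fin n) ℝ :=
  Matrix.of fun i j =>
    (⟪X (EuclideanSpace.single i 1), EuclideanSpace.single j 1⟫ +
      ⟪X (EuclideanSpace.single j 1), EuclideanSpace.single i 1⟫) / 2

lemma symMat_isSymm (X : Euc n →L[ℝ] Euc n) : (symMat X).IsSymm := by
  ext i j
  simp [symMat, add_comm]

lemma symMat_add (X Y : Euc n →L[ℝ] Euc n) : symMat (X + Y) = symMat X + symMat Y := by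
  ext i j
  simp only [symMat, Matrix.of_apply, Matrix.add_apply, _root_.add_apply, inner_add_left]
  ring

lemma symMat_smul (c : ℝ) (X : Euc n →L[ℝ] Euc n) : symMat (c • X) = c • symMat X := by
  ext i j
  simp only [symMat, Matrix.of_apply, Matrix.smul_apply, _root_.smul_apply, inner_smul_left,
    conj_trivial, smul_eq_mul]
  ring

lemma symMat_id : symMat (ContinuousLinearMap.id ℝ (Euc n)) = 1 := by
  ext i j
  by_cases h : i = j
  · subst h; simp [symMat]
  · simp [symMat, Matrix.one_apply_ne h, EuclideanSpace.inner_single_left, h, Ne.symm h]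

lemma gradient_eq_toDual_symm_comp (φ : Euc n → ℝ) :
    gradient φ = (InnerProductSpace.toDual ℝ (Euc n)).symm ∘ fderiv ℝ φ := rfl

lemma ContDiff.differentiable_gradient {φ : Euc n → ℝ} (hφ : ContDiff ℝ 2 φ) :
    Differentiable ℝ (gradient φ) := by
  rw [gradient_eq_toDual_symm_comp]
  have h : Differentiable ℝ (fderiv ℝ φ) :=
    (hφ.fderiv_right (m := 1) (by norm_num)).differentiable (by norm_num)
  exact (InnerProductSpace.toDual ℝ (Euc n)).symm.toContinuousLinearEquiv.differentiable.comp h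

lemma inner_fderiv_gradient {φ : Euc n → ℝ} (hφ : ContDiff ℝ 2 φ) (x h k : Euc n) :
    ⟪fderiv ℝ (gradient φ) x h, k⟫ = fderiv ℝ (fderiv ℝ φ) x h k := by
  have e : fderiv ℝ φ = fun y => innerSL ℝ (gradient φ y) := by
    funext y
    exact toDual_gradient.symm
  have h2 := (innerSL ℝ : Euc n →L[ℝ] _).hasFDerivAt.comp x
    (hφ.differentiable_gradient x).hasFDerivAt
  rw [e]
  exact (congrArg (fun L => L h k) h2.fderiv).symm

lemma hess_eq_symMat {φ : Euc n → ℝ} (hφ : ContDiff ℝ 2 φ) (x : Euc n) :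
    hess φ x = symMat (fderiv ℝ (gradient φ) x) := by
  have hs : IsSymmSndFDerivAt ℝ φ x := hφ.contDiffAt.isSymmSndFDerivAt (by simp)
  ext i j
  simp only [hess, symMat, iteratedFDeriv_two_apply, inner_fderiv_gradient hφ, Matrix.of_apply]
  rw [hs.eq (EuclideanSpace.single j 1)]
  simp

/-- The quadratic function with slope `q` and second order part `X` at `z`. -/
def quadTest (z q : Euc n) (X : Euc n →L[ℝ] Euc n) (x : Euc n) : ℝ :=
  ⟪q, x - z⟫ + 1 / 2 * ⟪X (x - z), x - z⟫

lemma contDiff_quadTest (z q : Euc n) (X : Euc n →L[ℝ] Euc n) :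
    ContDiff ℝ 2 (quadTest z q X) := by
  exact (contDiff_const.inner ℝ (by fun_prop)).add
    (contDiff_const.mul (ContDiff.inner ℝ (by fun_prop) (by fun_prop)))

lemma gradient_quadTest (z q : Euc n) (X : Euc n →L[ℝ] Euc n) :
    gradient (quadTest z q X) = fun x => q + ((1 / 2 : ℝ) • (X + adjoint X)) (x - z) := by
  refine gradient_eq fun x => ?_
  have h1 : HasFDerivAt (fun x : Euc n => x - z) (.id ℝ _) x := (hasFDerivAt_id x).sub_const z
  have h2 := (hasFDerivAt_const q x).inner ℝ h1
  have h3 := ((X.hasFDerivAt.comp x h1).inner ℝ h1).const_mul (1 / 2)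
  rw [hasGradientAt_iff_hasFDerivAt]
  refine (h2.add h3).congr_fderiv ?_
  ext k
  simp [inner_sub_left, inner_sub_right, adjoint_inner_left, real_inner_comm]
  ring

lemma hess_quadTest (z q : Euc n) (X : Euc n →L[ℝ] Euc n) (x : Euc n) :
    hess (quadTest z q X) x = symMat X := by
  rw [hess_eq_symMat (contDiff_quadTest z q X), gradient_quadTest]
  have h1 : HasFDerivAt (fun x : Euc n => q + ((1 / 2 : ℝ) • (X + adjoint X)) (x - z))
      ((1 / 2 : ℝ) • (X + adjoint X)) x := by
    simpa using (((1 / 2 : ℝ) • (X + adjoint X)).hasFDerivAt.comp x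
      ((hasFDerivAt_id x).sub_const z)).const_add q
  rw [h1.fderiv]
  ext i j
  simp only [symMat, Matrix.of_apply, _root_.smul_apply, _root_.add_apply, inner_smul_left,
    inner_add_left, adjoint_inner_left, conj_trivial]
  rw [real_inner_comm (X (EuclideanSpace.single i 1)),
    real_inner_comm (X (EuclideanSpace.single j 1))]
  ring

lemma quadTest_self (z q : Euc n) (X : Euc n →L[ℝ] Euc n) : quadTest z q X z = 0 := by
  simp [quadTest]

lemma gradient_quadTest_self (z q : Euc n) (X : Euc n →L[ℝ] Euc n) :
    gradient (quadTest z q X) z = q := by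
  simp [gradient_quadTest]

/-- Expansion of a quadratic function around a point other than its centre. -/
lemma quadTest_expand (x q : Euc n) (X : Euc n →L[ℝ] Euc n) (z h : Euc n) :
    quadTest x q X (z + h) = quadTest x q X z + ⟪gradient (quadTest x q X) z, h⟫ +
      1 / 2 * ⟪X h, h⟫ := by
  rw [gradient_quadTest]
  simp only [quadTest]
  rw [show z + h - x = (z - x) + h by abel]
  simp only [map_add, inner_add_left, inner_add_right, _root_.smul_apply, _root_.add_apply,
    inner_smul_left, adjoint_inner_left, conj_trivial]
  rw [real_inner_comm (z - x) (X h)]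
  ring

lemma gradient_eq_of_isLocalExtr {u φ : Euc n → ℝ} {z : Euc n} (hu : DifferentiableAt ℝ u z)
    (hφ : DifferentiableAt ℝ φ z) (h : IsLocalExtr (fun x => u x - φ x) z) :
    gradient u z = gradient φ z := by
  have h1 := h.fderiv_eq_zero
  rw [fderiv_fun_sub hu hφ, sub_eq_zero] at h1
  simp [gradient, h1]

lemma isLocalMax_sub_quadTest {u : Euc n → ℝ} {z q : Euc n} {X : Euc n →L[ℝ] Euc n}
    (h : ∀ᶠ k in 𝓝 (0 : Euc n), u (z + k) ≤ u z + ⟪q, k⟫ + 1 / 2 * ⟪X k, k⟫) :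
    IsLocalMax (fun x => u x - quadTest z q X x) z := by
  have ht : Tendsto (fun x : Euc n => x - z) (𝓝 z) (𝓝 0) := by
    simpa using (continuous_sub_right z).tendsto z
  filter_upwards [ht.eventually h] with x hx
  rw [add_sub_cancel] at hx
  simp only [quadTest_self]
  simp only [quadTest]
  linarith

lemma isLocalMin_sub_quadTest {u : Euc n → ℝ} {z q : Euc n} {X : Euc n →L[ℝ] Euc n}
    (h : ∀ᶠ k in 𝓝 (0 : Euc n), u z + ⟪q, k⟫ + 1 / 2 * ⟪X k, k⟫ ≤ u (z + k)) :
    IsLocalMin (fun x => u x - quadTest z q X x) z := by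
  have ht : Tendsto (fun x : Euc n => x - z) (𝓝 z) (𝓝 0) := by
    simpa using (continuous_sub_right z).tendsto z
  filter_upwards [ht.eventually h] with x hx
  rw [add_sub_cancel] at hx
  simp only [quadTest_self]
  simp only [quadTest]
  linarith

end TestFunctions

section Pucci

variable {n : ℕ} {lam Lam : ℝ}

lemma smul_one_mem_ellMat (h : lam ≤ Lam) :
    lam • (1 : Matrix (Fin n) (Fin n) ℝ) ∈ EllMat n lam Lam := by
  refine ⟨by simp [Matrix.IsSymm], fun ξ => ?_⟩
  rw [smul_mulVec, one_mulVec, dotProduct_smul, smul_eq_mul]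
  exact ⟨le_rfl, mul_le_mul_of_nonneg_right h (by
    simpa [dotProduct] using Finset.sum_nonneg fun i _ => mul_self_nonneg (ξ i))⟩

lemma ellMat_diag_le {A : Matrix (Fin n) (Fin n) ℝ} (hA : A ∈ EllMat n lam Lam) (i : Fin n) :
    lam ≤ A i i ∧ A i i ≤ Lam := by
  simpa using hA.2 (Pi.single i 1)

lemma ellMat_abs_le (hlam : 0 ≤ lam) {A : Matrix (Fin n) (Fin n) ℝ} (hA : A ∈ EllMat n lam Lam)
    (i j : Fin n) : |A i j| ≤ Lam := by
  by_cases hij : i = j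
  · subst hij
    have := ellMat_diag_le hA i
    rw [abs_of_nonneg (by linarith)]
    exact this.2
  have hs : A j i = A i j := hA.1.apply i j
  have h1 := hA.2 (Pi.single i 1 + Pi.single j 1)
  have h2 := ellMat_diag_le hA i
  have h3 := ellMat_diag_le hA j
  simp [mulVec_add, hij, Ne.symm hij, hs] at h1
  rw [abs_le]
  constructor <;> linarith

lemma bddAbove_trace_ellMat (hlam : 0 ≤ lam) (M : Matrix (Fin n) (Fin n) ℝ) :
    BddAbove ((fun A => (A * M).trace) '' EllMat n lam Lam) := by
  refine ⟨∑ i, ∑ j, Lam * |M j i|, ?_⟩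
  rintro _ ⟨A, hA, rfl⟩
  simp only [Matrix.trace, Matrix.diag, Matrix.mul_apply]
  refine Finset.sum_le_sum fun i _ => Finset.sum_le_sum fun j _ => ?_
  calc A i j * M j i ≤ |A i j * M j i| := le_abs_self _
    _ = |A i j| * |M j i| := abs_mul _ _
    _ ≤ _ := by gcongr; exact ellMat_abs_le hlam hA i j

lemma trace_mul_le_pucciSup (hlam : 0 ≤ lam) {A : Matrix (Fin n) (Fin n) ℝ}
    (hA : A ∈ EllMat n lam Lam) (M : Matrix (Fin n) (Fin n) ℝ) :
    (A * M).trace ≤ pucciSup n lam Lam M :=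
  le_csSup (bddAbove_trace_ellMat hlam M) ⟨A, hA, rfl⟩

lemma pucciSup_smul_add_smul_one_le (hlam : 0 ≤ lam) (h : lam ≤ Lam)
    (M : Matrix (Fin n) (Fin n) ℝ) {t s : ℝ} (ht : 0 ≤ t) (hs : 0 ≤ s) :
    pucciSup n lam Lam (t • M + s • 1) ≤ t * pucciSup n lam Lam M + s * (n * Lam) := by
  refine csSup_le (Set.Nonempty.image _ ⟨_, smul_one_mem_ellMat h⟩) ?_
  rintro _ ⟨A, hA, rfl⟩
  simp only [mul_add, mul_smul_comm, mul_one, trace_add, trace_smul, smul_eq_mul]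
  gcongr
  · exact trace_mul_le_pucciSup hlam hA M
  · calc A.trace ≤ ∑ _i : Fin n, Lam := Finset.sum_le_sum fun i _ => (ellMat_diag_le hA i).2
      _ = n * Lam := by simp

lemma pucciSup_nonneg_of_diag_nonneg (hlam : 0 ≤ lam) (h : lam ≤ Lam)
    {M : Matrix (Fin n) (Fin n) ℝ} (hM : ∀ i, 0 ≤ M i i) : 0 ≤ pucciSup n lam Lam M := by
  refine le_trans ?_ (trace_mul_le_pucciSup hlam (smul_one_mem_ellMat h) M)
  rw [smul_mul_assoc, one_mul, trace_smul]
  exact mul_nonneg hlam (Finset.sum_nonneg fun i _ => hM i)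

end Pucci

section DirectionalDerivative

open Filter Topology ContinuousLinearMap

variable {n : ℕ}

/-- If the directional derivative `∂ₑu` is touched from above at `x₀` by a `C²` function `φ`, then
`u` can be touched from above and from below at nearby points, with slopes and second order parts
controlled by the derivatives of `φ`. -/
lemma exists_touching_of_directional_derivative {u φ : Euc n → ℝ} {Ω : Set (Euc n)} {x₀ e : Euc n}
    (hΩ : Ω ∈ 𝓝 x₀) (hu : ∀ x ∈ Ω, DifferentiableAt ℝ u x) (hgrad : ContinuousOn (gradient u) Ω)
    (he : ‖e‖ = 1) (hφ : ContDiff ℝ 2 φ)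
    (hmax : ∀ᶠ x in 𝓝 x₀, ⟪gradient u x, e⟫ - φ x ≤ ⟪gradient u x₀, e⟫ - φ x₀)
    {ε : ℝ} (hε : 0 < ε) (hε1 : ε ≤ 1) :
    ∃ (t : ℝ) (a b q₁ q₂ : Euc n) (X₁ X₂ : Euc n →L[ℝ] Euc n), 0 < t ∧ a ∈ Ω ∧ b ∈ Ω ∧
      ‖a - b‖ ≤ t * (1 + ε) ∧
      ‖q₁ - q₂‖ ≤ t * (‖gradient φ x₀‖ + (‖fderiv ℝ (gradient φ) x₀‖ + 5) * ε) ∧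
      X₁ = X₂ + (t • fderiv ℝ (gradient φ) x₀ + (t * (8 * ε)) • .id ℝ (Euc n)) ∧
      (∀ᶠ h in 𝓝 (0 : Euc n), u (a + h) ≤ u a + ⟪q₁, h⟫ + 1 / 2 * ⟪X₁ h, h⟫) ∧
      ∀ᶠ h in 𝓝 (0 : Euc n), u b + ⟪q₂, h⟫ + 1 / 2 * ⟪X₂ h, h⟫ ≤ u (b + h) := by
  set T := fderiv ℝ (gradient φ) x₀ with hT
  set p₀ := gradient φ x₀ with hp₀
  set A : Euc n →L[ℝ] Euc n := T + (4 * ε) • .id ℝ (Euc n) with hA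
  set Q := quadTest x₀ p₀ A with hQ
  set G : Euc n → ℝ := fun x => ⟪gradient u x, e⟫ with hG
  have hest : ∀ᶠ x in 𝓝 x₀, G x ≤ G x₀ + Q x - ε * ‖x - x₀‖ ^ 2 := by
    have htay := eventually_abs_taylor_two_le (x := x₀) (q := gradient φ)
      (Eventually.of_forall fun y => (hφ.differentiable (by norm_num) y).hasGradientAt)
      (hφ.differentiable_gradient x₀).hasFDerivAt hε
    have ht : Tendsto (fun x : Euc n => x - x₀) (𝓝 x₀) (𝓝 0) := by
      simpa using (continuous_sub_right x₀).tendsto x₀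
    filter_upwards [ht.eventually htay, hmax] with x hx hx'
    rw [add_sub_cancel] at hx
    have hx2 := (abs_le.1 hx).2
    have : Q x = ⟪p₀, x - x₀⟫ + 1 / 2 * ⟪T (x - x₀), x - x₀⟫ + 2 * ε * ‖x - x₀‖ ^ 2 := by
      simp only [hQ, quadTest, hA, _root_.add_apply, _root_.smul_apply, inner_add_left,
        inner_smul_left, ContinuousLinearMap.id_apply, real_inner_self_eq_norm_sq, conj_trivial]
      ring
    simp only [hG]
    linarith
  obtain ⟨R, hR, hRsub⟩ := Metric.nhds_basis_closedBall.mem_iff.1 (inter_mem hΩ hest)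
  have hGc : ContinuousOn G Ω := hgrad.inner continuousOn_const
  have hRΩ : closedBall x₀ R ⊆ Ω := fun x hx => (hRsub hx).1
  have huc : ContinuousOn u (closedBall x₀ R) := fun x hx =>
    (hu x (hRΩ hx)).continuousAt.continuousWithinAt
  set ρ := min (R / 4) ε with hρ
  have hρ0 : 0 < ρ := by positivity
  have hρR : ρ ≤ R / 4 := min_le_left _ _
  have hρε : ρ ≤ ε := min_le_right _ _
  obtain ⟨δ, hδ, hδG⟩ := Metric.uniformContinuousOn_iff.1
    ((isCompact_closedBall x₀ R).uniformContinuousOn_of_continuous (hGc.mono hRΩ))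
    (ε * ρ ^ 2 / 4) (by positivity)
  set t := min (R / 2) (δ / 2) with ht
  have ht0 : 0 < t := by positivity
  have htR : t ≤ R / 2 := min_le_left _ _
  have htδ : t < δ := (min_le_right _ _).trans_lt (by linarith)
  have hmem : ∀ x ∈ closedBall x₀ (R / 2), ∀ s ∈ Icc 0 t, x + s • e ∈ closedBall x₀ R := by
    intro x hx s hs
    rw [mem_closedBall_iff_norm] at hx ⊢
    calc ‖x + s • e - x₀‖ = ‖(x - x₀) + s • e‖ := by congr 1; abel
      _ ≤ ‖x - x₀‖ + ‖s • e‖ := norm_add_le _ _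
      _ ≤ R / 2 + R / 2 := by
        gcongr
        rw [norm_smul, he, mul_one, Real.norm_of_nonneg hs.1]
        exact hs.2.trans htR
      _ = R := by ring
  have hdiff : ∀ x ∈ closedBall x₀ (R / 2),
      |u (x + t • e) - u x - t * G x| ≤ t * (ε * ρ ^ 2 / 4) := by
    intro x hx
    have hd : ∀ s ∈ Icc 0 t, HasDerivAt (fun s : ℝ => u (x + s • e)) (G (x + s • e)) s := by
      intro s hs
      have h1 : HasDerivAt (fun s : ℝ => x + s • e) e s := by
        simpa using ((hasDerivAt_id s).smul_const e).const_add x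
      have h2 := (hu _ (hRΩ (hmem x hx s hs))).hasGradientAt.hasFDerivAt.comp_hasDerivAt s h1
      exact h2.congr_deriv InnerProductSpace.toDual_apply_apply
    obtain ⟨s, hs, hs'⟩ := exists_hasDerivAt_eq_slope _ _ ht0
      (fun s hs => (hd s hs).continuousAt.continuousWithinAt)
      fun s hs => hd s (Ioo_subset_Icc_self hs)
    rw [eq_div_iff (by simpa using ht0.ne')] at hs'
    simp only [zero_smul, add_zero, sub_zero] at hs'
    have hx0 : x ∈ closedBall x₀ R := by simpa using hmem x hx 0 ⟨le_rfl, ht0.le⟩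
    have hclose := hδG _ (hmem x hx s (Ioo_subset_Icc_self hs)) x hx0 (by
      rw [dist_eq_norm, add_sub_cancel_left, norm_smul, he, mul_one, Real.norm_of_nonneg hs.1.le]
      exact hs.2.trans htδ)
    rw [Real.dist_eq] at hclose
    rw [← hs', mul_comm, ← mul_sub, abs_mul, abs_of_pos ht0]
    gcongr
  have hcontQ : Continuous Q := (contDiff_quadTest x₀ p₀ A).continuous
  obtain ⟨z, y, p, q, X, hz, hy, hzy, hp, hv, hu'⟩ := exists_second_order_touching
    (x₁ := x₀) (r := R / 2) (ρ := ρ) (γ := t * (ε * ρ ^ 2 / 2)) (η := t * ε)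
    (v := fun x => u (x + t • e) - t * Q x) (u := u)
    ((huc.comp (by fun_prop) fun x hx => hmem x hx t ⟨ht0.le, le_rfl⟩).sub
      (hcontQ.const_mul t).continuousOn)
    (huc.mono (closedBall_subset_closedBall (by linarith))) hρ0 (by linarith) (by positivity)
    (by positivity) (by
      intro x hx hρx
      have h1 := (abs_le.1 (hdiff x hx)).2
      have h2 := (abs_le.1 (hdiff x₀ (mem_closedBall_self (by linarith)))).1
      have h3 : G x ≤ G x₀ + Q x - ε * ‖x - x₀‖ ^ 2 :=
        (hRsub (closedBall_subset_closedBall (by linarith) hx)).2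
      have h4 : ε * ρ ^ 2 ≤ ε * ‖x - x₀‖ ^ 2 := by gcongr
      have h5 : t * G x ≤ t * (G x₀ + Q x - ε * ρ ^ 2) := by gcongr; linarith
      have h6 : Q x₀ = 0 := quadTest_self x₀ p₀ A
      simp only [h6]
      linarith)
  have hz' : z ∈ closedBall x₀ (R / 2) :=
    closedBall_subset_closedBall (by linarith) (ball_subset_closedBall hz)
  refine ⟨t, z + t • e, y, q + t • gradient Q z, q - p, X + t • A + (2 * (t * ε)) • .id ℝ (Euc n),
    X - (2 * (t * ε)) • .id ℝ (Euc n), ht0, hRΩ (hmem z hz' t ⟨ht0.le, le_rfl⟩),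
    hRΩ (closedBall_subset_closedBall (by linarith) (ball_subset_closedBall hy)),
    ?_, ?_, ?_, ?_, ?_⟩
  · calc ‖z + t • e - y‖ = ‖(z - y) + t • e‖ := by congr 1; abel
      _ ≤ ‖z - y‖ + ‖t • e‖ := norm_add_le _ _
      _ ≤ t * ε + t := by
        rw [norm_smul, he, mul_one, Real.norm_of_nonneg ht0.le]
        gcongr
      _ = _ := by ring
  · have hAn : ‖A‖ ≤ ‖T‖ + 4 := by
      refine (norm_add_le _ _).trans ?_
      gcongr
      refine (opNorm_smul_le _ _).trans ?_
      rw [Real.norm_of_nonneg (by positivity)]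
      nlinarith [ContinuousLinearMap.norm_id_le (𝕜 := ℝ) (E := Euc n)]
    have hS : ‖(1 / 2 : ℝ) • (A + adjoint A)‖ ≤ ‖T‖ + 4 := by
      refine (opNorm_smul_le _ _).trans ?_
      have := norm_add_le A (adjoint A)
      rw [LinearIsometryEquiv.norm_map] at this
      rw [Real.norm_of_nonneg (by norm_num)]
      linarith
    have hgQ : ‖gradient Q z‖ ≤ ‖p₀‖ + (‖T‖ + 4) * ε := by
      rw [hQ, gradient_quadTest]
      refine (norm_add_le _ _).trans ?_
      gcongr
      refine (le_opNorm _ _).trans ?_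
      gcongr
      exact (mem_ball_iff_norm.1 hz).le.trans hρε
    calc ‖q + t • gradient Q z - (q - p)‖ = ‖t • gradient Q z + p‖ := by congr 1; abel
      _ ≤ ‖t • gradient Q z‖ + ‖p‖ := norm_add_le _ _
      _ ≤ t * (‖p₀‖ + (‖T‖ + 4) * ε) + t * ε := by
        rw [norm_smul, Real.norm_of_nonneg ht0.le]
        gcongr
      _ = _ := by ring
  · rw [hA]
    module
  · filter_upwards [hv] with h hh
    have h1 := quadTest_expand x₀ p₀ A z h
    rw [← hQ] at h1
    rw [h1, show z + h + t • e = z + t • e + h by abel] at hh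
    simp only [_root_.add_apply, _root_.smul_apply, inner_add_left, inner_smul_left,
      ContinuousLinearMap.id_apply, real_inner_self_eq_norm_sq, conj_trivial]
    linarith
  · filter_upwards [hu'] with h hh
    simp only [_root_.sub_apply, _root_.smul_apply, inner_sub_left, inner_smul_left,
      ContinuousLinearMap.id_apply, real_inner_self_eq_norm_sq, conj_trivial] at hh ⊢
    linarith

lemma diag_hess_nonneg_of_isLocalMin {φ : Euc n → ℝ} {x : Euc n} (hφ : ContDiff ℝ 2 φ)
    (h : IsLocalMin φ x) (i : Fin n) : 0 ≤ hess φ x i i := by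
  have hgrad : gradient φ x = 0 := by simp [gradient, h.fderiv_eq_zero]
  refine le_of_forall_pos_le_add fun ε hε => ?_
  have htay := eventually_abs_taylor_two_le (x := x) (q := gradient φ) (η := ε / 2)
    (Eventually.of_forall fun y => (hφ.differentiable (by norm_num) y).hasGradientAt)
    (hφ.differentiable_gradient x).hasFDerivAt (by positivity)
  have ht : Tendsto (fun k : Euc n => x + k) (𝓝 0) (𝓝 x) := by
    simpa using (continuous_const_add x).tendsto 0
  have hs : Tendsto (fun s : ℝ => s • (EuclideanSpace.single i 1 : Euc n)) (𝓝[>] 0) (𝓝 0) := by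
    refine Tendsto.mono_left ?_ nhdsWithin_le_nhds
    have hc : Continuous fun s : ℝ => s • (EuclideanSpace.single i 1 : Euc n) := by fun_prop
    simpa using hc.tendsto 0
  obtain ⟨s, ⟨hs1, hs2⟩, hs0⟩ :=
    ((hs.eventually (htay.and (ht.eventually h))).and self_mem_nhdsWithin).exists
  have hs0 : 0 < s := hs0
  have h1 := (abs_le.1 hs1).2
  rw [hess_eq_symMat hφ]
  simp only [hgrad, inner_zero_left, map_smul, inner_smul_left, inner_smul_right, norm_smul,
    PiLp.norm_single, norm_one, mul_one, conj_trivial, Real.norm_of_nonneg hs0.le] at h1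
  simp only [symMat, Matrix.of_apply]
  have h2 : 0 ≤ s ^ 2 * ((⟪fderiv ℝ (gradient φ) x (EuclideanSpace.single i 1),
      EuclideanSpace.single i 1⟫ + ε) / 2) := by linarith
  have h3 := nonneg_of_mul_nonneg_right h2 (by positivity)
  linarith

lemma abs_rpow_neg_sub_rpow_neg_le {q μ a b : ℝ} (hq : 0 ≤ q) (hμ : 0 < μ) (ha : μ ≤ a)
    (hb : μ ≤ b) : |a ^ (-q) - b ^ (-q)| ≤ q * μ ^ (-q - 1) * |a - b| := by
  refine (convex_Ici μ).norm_image_sub_le_of_norm_hasDerivWithin_le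
    (f := fun x : ℝ => x ^ (-q)) (f' := fun x : ℝ => -q * x ^ (-q - 1))
    (fun x hx => (Real.hasDerivAt_rpow_const (Or.inl (hμ.trans_le hx).ne')).hasDerivWithinAt)
    (fun x hx => ?_) hb ha
  have hx0 : 0 < x := hμ.trans_le hx
  rw [norm_mul, norm_neg, Real.norm_of_nonneg hq, Real.norm_of_nonneg (by positivity)]
  gcongr q * ?_
  exact Real.rpow_le_rpow_of_nonpos hμ hx (by linarith)

lemma neg_le_sub_of_le_rpow_mul {q μ a₁ a₂ f₁ f₂ F₁ F₂ D C : ℝ} (hq : 0 ≤ q) (hμ : 0 < μ)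
    (ha₁ : μ ≤ a₁) (ha₂ : μ ≤ a₂) (h₁ : f₁ ≤ a₁ ^ q * F₁) (h₂ : a₂ ^ q * F₂ ≤ f₂)
    (hD : |f₁ - f₂| ≤ D) (hC : |f₁| ≤ C) :
    -(μ ^ (-q) * D) - q * μ ^ (-q - 1) * C * |a₁ - a₂| ≤ F₁ - F₂ := by
  have ha₁0 : 0 < a₁ := hμ.trans_le ha₁
  have ha₂0 : 0 < a₂ := hμ.trans_le ha₂
  have hF₁ : f₁ * a₁ ^ (-q) ≤ F₁ := by
    rw [Real.rpow_neg ha₁0.le, ← div_eq_mul_inv, div_le_iff₀ (by positivity)]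
    linarith
  have hF₂ : F₂ ≤ f₂ * a₂ ^ (-q) := by
    rw [Real.rpow_neg ha₂0.le, ← div_eq_mul_inv, le_div_iff₀ (by positivity)]
    linarith
  have hα : a₂ ^ (-q) ≤ μ ^ (-q) := Real.rpow_le_rpow_of_nonpos hμ ha₂ (by linarith)
  have h3 : |(f₁ - f₂) * a₂ ^ (-q)| ≤ D * μ ^ (-q) := by
    rw [abs_mul, abs_of_nonneg (show 0 ≤ a₂ ^ (-q) by positivity)]
    have hD0 : 0 ≤ D := (abs_nonneg _).trans hD
    gcongr
  have h4 : |f₁ * (a₁ ^ (-q) - a₂ ^ (-q))| ≤ C * (q * μ ^ (-q - 1) * |a₁ - a₂|) := by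
    rw [abs_mul]
    gcongr
    · exact (abs_nonneg _).trans hC
    · exact abs_rpow_neg_sub_rpow_neg_le hq hμ ha₁ ha₂
  have h5 := (abs_le.1 h3).1
  have h6 := (abs_le.1 h4).1
  linarith

/-- The viscosity inequality satisfied by `∂ₑu` at a point where it exceeds `κ + μ`. -/
lemma neg_le_pucciSup_hess_of_directional_derivative {lam Lam κ q μ C L : ℝ}
    (hlam : 0 ≤ lam) (hlamLam : lam ≤ Lam) (hq : 0 ≤ q) (hμ : 0 < μ)
    {F : Matrix (Fin n) (Fin n) ℝ → ℝ} (hF : IsUniformlyElliptic n lam Lam F)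
    {f u φ : Euc n → ℝ} {Ω : Set (Euc n)} (hΩ : IsOpen Ω) (hC : ∀ x ∈ Ω, |f x| ≤ C)
    (hL : ∀ x ∈ Ω, ∀ y ∈ Ω, |f x - f y| ≤ L * ‖x - y‖) (hL0 : 0 ≤ L)
    (hsol : ViscSol (mainG κ q F) f Ω u) (hu : ContDiffOn ℝ 1 u Ω) {x₀ e : Euc n} (he : ‖e‖ = 1)
    (hx₀ : x₀ ∈ Ω) (hslope : κ + μ < ⟪gradient u x₀, e⟫) (hφ : ContDiff ℝ 2 φ)
    (hmax : ∀ᶠ x in 𝓝 x₀, ⟪gradient u x, e⟫ - φ x ≤ ⟪gradient u x₀, e⟫ - φ x₀) :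
    -(μ ^ (-q) * L) ≤
      pucciSup n lam Lam (hess φ x₀) + q * μ ^ (-q - 1) * C * ‖gradient φ x₀‖ := by
  have hgrad : ContinuousOn (gradient u) Ω := by
    rw [gradient_eq_toDual_symm_comp]
    exact (LinearIsometryEquiv.continuous _).comp_continuousOn
      (hu.continuousOn_fderiv_of_isOpen hΩ le_rfl)
  have hdiff : ∀ x ∈ Ω, DifferentiableAt ℝ u x := fun x hx =>
    (hu.differentiableOn (by norm_num)).differentiableAt (hΩ.mem_nhds hx)
  have hC0 : 0 ≤ C := (abs_nonneg _).trans (hC x₀ hx₀)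
  set N : Set (Euc n) := Ω ∩ {x | κ + μ < ⟪gradient u x, e⟫} with hN
  have hNnhds : N ∈ 𝓝 x₀ := inter_mem (hΩ.mem_nhds hx₀)
    (((hgrad.continuousAt (hΩ.mem_nhds hx₀)).inner continuousAt_const).eventually
      (lt_mem_nhds hslope))
  have hnorm : ∀ x ∈ N, μ ≤ ‖gradient u x‖ - κ := by
    intro x hx
    have h1 := real_inner_le_norm (gradient u x) e
    rw [he, mul_one] at h1
    have h2 : κ + μ < ⟪gradient u x, e⟫ := hx.2
    linarith
  have key : ∀ ε ∈ Ioc (0 : ℝ) 1, -(μ ^ (-q) * (L * (1 + ε))) ≤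
      pucciSup n lam Lam (hess φ x₀) + 8 * ε * (n * Lam) + q * μ ^ (-q - 1) * C *
        (‖gradient φ x₀‖ + (‖fderiv ℝ (gradient φ) x₀‖ + 5) * ε) := by
    rintro ε ⟨hε, hε1⟩
    obtain ⟨t, a, b, q₁, q₂, X₁, X₂, ht, ha, hb, hab, hqq, hX, h₁, h₂⟩ :=
      exists_touching_of_directional_derivative hNnhds (fun x hx => hdiff x hx.1)
        (hgrad.mono inter_subset_left) he hφ hmax hε hε1
    have hmax₁ := isLocalMax_sub_quadTest h₁
    have hmin₂ := isLocalMin_sub_quadTest h₂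
    have hg₁ : gradient u a = q₁ := by
      rw [gradient_eq_of_isLocalExtr (hdiff a ha.1)
        ((contDiff_quadTest a q₁ X₁).differentiable (by norm_num) a) hmax₁.isExtr,
        gradient_quadTest_self]
    have hg₂ : gradient u b = q₂ := by
      rw [gradient_eq_of_isLocalExtr (hdiff b hb.1)
        ((contDiff_quadTest b q₂ X₂).differentiable (by norm_num) b) hmin₂.isExtr,
        gradient_quadTest_self]
    have hn₁ : μ ≤ ‖q₁‖ - κ := hg₁ ▸ hnorm a ha
    have hn₂ : μ ≤ ‖q₂‖ - κ := hg₂ ▸ hnorm b hb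
    have hv₁ := hsol.1 a ha.1 _ (contDiff_quadTest a q₁ X₁) hmax₁
    have hv₂ := hsol.2 b hb.1 _ (contDiff_quadTest b q₂ X₂) hmin₂
    rw [gradient_quadTest_self, hess_quadTest, mainG, max_eq_left (hμ.le.trans hn₁)] at hv₁
    rw [gradient_quadTest_self, hess_quadTest, mainG, max_eq_left (hμ.le.trans hn₂)] at hv₂
    have hlow := neg_le_sub_of_le_rpow_mul hq hμ hn₁ hn₂ hv₁ hv₂ (hL a ha.1 b hb.1) (hC a ha.1)
    have hup := (hF _ _ (symMat_isSymm X₁) (symMat_isSymm X₂)).2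
    have hM : symMat X₁ - symMat X₂ = t • hess φ x₀ + (t * (8 * ε)) • 1 := by
      rw [hX, symMat_add, symMat_add, symMat_smul, symMat_smul, symMat_id, hess_eq_symMat hφ,
        add_sub_cancel_left]
    rw [hM] at hup
    have hpuc := pucciSup_smul_add_smul_one_le hlam hlamLam (hess φ x₀) ht.le
      (show 0 ≤ t * (8 * ε) by positivity)
    have hslopes : |‖q₁‖ - κ - (‖q₂‖ - κ)| ≤
        t * (‖gradient φ x₀‖ + (‖fderiv ℝ (gradient φ) x₀‖ + 5) * ε) := by
      rw [sub_sub_sub_cancel_right]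
      exact (abs_norm_sub_norm_le _ _).trans hqq
    have h3 : μ ^ (-q) * (L * ‖a - b‖) ≤ μ ^ (-q) * (L * (t * (1 + ε))) := by gcongr
    have h4 : q * μ ^ (-q - 1) * C * |‖q₁‖ - κ - (‖q₂‖ - κ)| ≤ q * μ ^ (-q - 1) * C *
        (t * (‖gradient φ x₀‖ + (‖fderiv ℝ (gradient φ) x₀‖ + 5) * ε)) := by gcongr
    refine le_of_mul_le_mul_left ?_ ht
    linarith
  have hlim : ContinuousWithinAt (fun ε : ℝ => pucciSup n lam Lam (hess φ x₀) +
      8 * ε * (n * Lam) + q * μ ^ (-q - 1) * C * (‖gradient φ x₀‖ +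
        (‖fderiv ℝ (gradient φ) x₀‖ + 5) * ε) + μ ^ (-q) * (L * (1 + ε))) (Ioi 0) 0 :=
    Continuous.continuousWithinAt (by fun_prop)
  have := ge_of_tendsto (b := (0 : ℝ)) hlim (by
    filter_upwards [Ioc_mem_nhdsGT (zero_lt_one' ℝ)] with ε hε
    linarith [key ε hε])
  simp only [mul_zero, zero_mul, add_zero, mul_one] at this
  linarith

end DirectionalDerivative

/-- Lemma 5.3: `w = (∂_e u - (κ+μ))₊` is a viscosity subsolution of
`M⁺(D²w) + qμ^{-q-1}‖f‖_∞ |Dw| = -μ^{-q} Lip(f)` in `B₁`. -/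
theorem truncated_derivative_subsolution
    (n : ℕ) (hn : 1 ≤ n) (lam Lam κ q μ Mf Lf : ℝ)
    (hlam : 0 < lam) (hlamLam : lam ≤ Lam) (hκ : 0 < κ) (hq : 0 ≤ q) (hμ : 0 < μ)
    (F : Matrix (Fin n) (Fin n) ℝ → ℝ) (hF : IsUniformlyElliptic n lam Lam F)
    (f u : Euc n → ℝ)
    (hfb : ∀ x ∈ closedBall (0 : Euc n) 1, |f x| ≤ Mf)
    (hfLip : ∀ x ∈ closedBall (0 : Euc n) 1, ∀ y ∈ closedBall (0 : Euc n) 1,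
      |f x - f y| ≤ Lf * ‖x - y‖)
    (hu : ContinuousOn u (ball 0 1))
    (hsol : EffectiveSol κ q F f (ball 0 1) u)
    (hu1 : ContDiffOn ℝ 1 u (omegaSet κ (ball 0 1) u))
    (e : Euc n) (he : ‖e‖ = 1) :
    ∀ x₀ ∈ ball (0 : Euc n) 1, ∀ φ : Euc n → ℝ, ContDiff ℝ 2 φ →
      IsLocalMax (fun x =>
        (omegaSet κ (ball 0 1) u).indicator
          (fun z => max (⟪gradient u z, e⟫ - (κ + μ)) 0) x - φ x) x₀ →
      -(μ ^ (-q) * Lf) ≤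
        pucciSup n lam Lam (hess φ x₀) +
          q * μ ^ (-q - 1) * Mf * ‖gradient φ x₀‖ := by
  intro x₀ hx₀ φ hφ hmax
  set Ω := omegaSet κ (ball 0 1) u with hΩ
  have hΩ1 : Ω ⊆ closedBall 0 1 := fun x hx => ball_subset_closedBall hx.1
  have hL0 : 0 ≤ Lf := by
    have h := hfLip e (by simp [he]) 0 (by simp)
    rw [sub_zero, he, mul_one] at h
    exact (abs_nonneg _).trans h
  have hM0 : 0 ≤ Mf := (abs_nonneg _).trans (hfb 0 (by simp))
  by_cases hpos : x₀ ∈ Ω ∧ κ + μ < ⟪gradient u x₀, e⟫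
  · refine neg_le_pucciSup_hess_of_directional_derivative hlam.le hlamLam hq hμ hF hsol.1
      (fun x hx => hfb x (hΩ1 hx)) (fun x hx y hy => hfLip x (hΩ1 hx) y (hΩ1 hy)) hL0 hsol.2 hu1 he
      hpos.1 hpos.2 hφ ?_
    filter_upwards [hmax, hsol.1.mem_nhds hpos.1] with x hx hxΩ
    rw [indicator_of_mem hxΩ, indicator_of_mem hpos.1,
      max_eq_left (a := ⟪gradient u x₀, e⟫ - (κ + μ)) (by linarith [hpos.2])] at hx
    linarith [le_max_left (⟪gradient u x, e⟫ - (κ + μ)) 0]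
  · have hw₀ : Ω.indicator (fun z => max (⟪gradient u z, e⟫ - (κ + μ)) 0) x₀ = 0 := by
      by_cases hx : x₀ ∈ Ω
      · rw [indicator_of_mem hx]
        exact max_eq_right (by linarith [not_lt.1 fun h => hpos ⟨hx, h⟩])
      · exact indicator_of_notMem hx _
    have hmin : IsLocalMin φ x₀ := by
      filter_upwards [hmax] with x hx
      have : 0 ≤ Ω.indicator (fun z => max (⟪gradient u z, e⟫ - (κ + μ)) 0) x :=
        indicator_nonneg (fun _ _ => le_max_right _ _) x
      rw [hw₀] at hx
      linarith
    have h1 := pucciSup_nonneg_of_diag_nonneg hlam.le hlamLam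
      (diag_hess_nonneg_of_isLocalMin hφ hmin)
    have h2 : 0 ≤ μ ^ (-q) * Lf := by positivity
    have h3 : 0 ≤ q * μ ^ (-q - 1) * Mf * ‖gradient φ x₀‖ := by positivity
    linarith

end
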